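/- arXiv:2106.02801 — 3 statements merged into one kernel-verified Lean document; each statement's English description precedes it below -/
import Mathlib

section
/- Let (Ω, P) be a probability space, x : Ω → ℝ^n a random vector, C ∈ ℝ^{k×n}, x̄_nom, p̄ ∈ ℝ^n with C(x̄_nom − p̄) ≠ 0, r > 0, and ε ∈ [0,1]. If P({ω : (x̄_nom − p̄)ᵀCᵀC(x(ω) − p̄) ≥ r·‖C(x̄_nom − p̄)‖₂}) ≥ 1 − ε, then P({ω : ‖C(x(ω) − p̄)‖₂ ≥ r}) ≥ 1 − ε. -/
open MeasureTheory Matrix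

/-- **Lemma 9: collision checking with a deterministic obstacle.**
The linearized chance constraint is a conservative approximation of the nonlinear
collision chance constraint `P(‖C(x − p̄)‖₂ ≥ r) ≥ 1 − ε`. -/
theorem linearized_chance_constraint_implies_collision_chance_constraint
    {Ω : Type*} [MeasurableSpace Ω] (P : Measure Ω) [IsProbabilityMeasure P]
    {k n : ℕ} (x : Ω → Fin n → ℝ) (hxmeas : Measurable x)
    (C : Matrix (Fin k) (Fin n) ℝ) (xnom pbar : Fin n → ℝ)
    (hne : C.mulVec (xnom - pbar) ≠ 0)
    (r : ℝ) (hr : 0 < r) (ε : ℝ) (hε0 : 0 ≤ ε) (hε1 : ε ≤ 1)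
    (h : ENNReal.ofReal (1 - ε)
        ≤ P {ω | r * Real.sqrt (∑ i, C.mulVec (xnom - pbar) i ^ 2)
            ≤ dotProduct (C.mulVec (xnom - pbar)) (C.mulVec (x ω - pbar))}) :
    ENNReal.ofReal (1 - ε)
      ≤ P {ω | r ≤ Real.sqrt (∑ i, C.mulVec (x ω - pbar) i ^ 2)} := by
  refine h.trans (measure_mono fun ω hω => ?_)
  have hpos : 0 < Real.sqrt (∑ i, C.mulVec (xnom - pbar) i ^ 2) := by
    obtain ⟨i, hi⟩ := Function.ne_iff.mp hne
    exact Real.sqrt_pos.mpr (Finset.sum_pos' (fun j _ => sq_nonneg _)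
      ⟨i, Finset.mem_univ i, sq_pos_of_ne_zero hi⟩)
  have hle := le_trans hω
    (Real.sum_mul_le_sqrt_mul_sqrt Finset.univ
      (C.mulVec (xnom - pbar)) (C.mulVec (x ω - pbar)))
  rw [mul_comm] at hle
  exact le_of_mul_le_mul_left hle hpos
end

section
/- Let (Ω, P) be a probability space, x : Ω → ℝ^n and p : Ω → ℝ^n random vectors defined on the same space, C ∈ ℝ^{k×n}, x̄_nom, p̄_obs ∈ ℝ^n with C(x̄_nom − p̄_obs) ≠ 0, r > 0, and ε ∈ [0,1]. If P({ω : (x̄_nom − p̄_obs)ᵀCᵀC(x(ω) − p(ω)) ≥ r·‖C(x̄_nom − p̄_obs)‖₂}) ≥ 1 − ε, then P({ω : ‖C(x(ω) − p(ω))‖₂ ≥ r}) ≥ 1 − ε. -/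
open MeasureTheory Matrix

/-- If `⟪u, v⟫ ≥ r ‖u‖₂` for some nonzero `u`, then `‖v‖₂ ≥ r`. -/
theorem le_sqrt_sum_sq_of_mul_sqrt_sum_sq_le_dotProduct {ι : Type*} [Fintype ι]
    {u v : ι → ℝ} (hu : u ≠ 0) {r : ℝ}
    (h : r * Real.sqrt (∑ i, u i ^ 2) ≤ dotProduct u v) :
    r ≤ Real.sqrt (∑ i, v i ^ 2) := by
  obtain ⟨j, hj⟩ := Function.ne_iff.mp hu
  have hpos : 0 < Real.sqrt (∑ i, u i ^ 2) :=
    Real.sqrt_pos.mpr <| Finset.sum_pos' (fun i _ => sq_nonneg (u i))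
      ⟨j, Finset.mem_univ j, sq_pos_of_ne_zero hj⟩
  refine le_of_mul_le_mul_right (h.trans ?_) hpos
  rw [mul_comm]
  exact Real.sum_mul_le_sqrt_mul_sqrt Finset.univ u v

/-- **Lemma 10: collision checking with a stochastic obstacle.**
The linearized chance constraint in the pair `(x, p)` is a conservative
approximation of the nonlinear collision chance constraint
`P(‖C(x − p)‖₂ ≥ r) ≥ 1 − ε`. -/
theorem linearized_chance_constraint_implies_stochastic_collision_constraint
    {Ω : Type*} [MeasurableSpace Ω] (P : Measure Ω) [IsProbabilityMeasure P]
    {k n : ℕ} (x p : Ω → Fin n → ℝ) (hxmeas : Measurable x) (hpmeas : Measurable p)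
    (C : Matrix (Fin k) (Fin n) ℝ) (xnom pobs : Fin n → ℝ)
    (hne : C.mulVec (xnom - pobs) ≠ 0)
    (r : ℝ) (hr : 0 < r) (ε : ℝ) (hε0 : 0 ≤ ε) (hε1 : ε ≤ 1)
    (h : ENNReal.ofReal (1 - ε)
        ≤ P {ω | r * Real.sqrt (∑ i, C.mulVec (xnom - pobs) i ^ 2)
            ≤ dotProduct (C.mulVec (xnom - pobs)) (C.mulVec (x ω - p ω))}) :
    ENNReal.ofReal (1 - ε)
      ≤ P {ω | r ≤ Real.sqrt (∑ i, C.mulVec (x ω - p ω) i ^ 2)} := by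
  exact h.trans (measure_mono fun _ hω =>
    le_sqrt_sum_sq_of_mul_sqrt_sum_sq_le_dotProduct hne hω)
end

section
/- Let (Ω, P) be a probability space, ξ : Ω → ℝ^{d_ξ} a random vector, φ : ℝ^{d_ξ} → ℝ a measurable function with k = E[φ(ξ)²] > 0, and Φ̄ : ℝ^{d_ξ} → ℝ^{d × n} a measurable matrix-valued function. Let f : ℝ^d × ℝ^{d_u} → ℝ^d be globally K-Lipschitz, i.e. ‖f(s₁) − f(s₂)‖₂ ≤ K‖s₁ − s₂‖₂ for all s₁, s₂ ∈ ℝ^d × ℝ^{d_u} (with the Euclidean norm on the product). Suppose L(ξ) := |φ(ξ)|·‖blkdiag(Φ̄(ξ), I_{d_u})‖₂ is integrable, where ‖·‖₂ denotes the spectral (operator) norm and blkdiag(Φ̄(ξ), I_{d_u}) is the block-diagonal matrix with blocks Φ̄(ξ) and the d_u×d_u identity. Then for each component index i, the map (X, ū) ↦ (1/k)·E[φ(ξ)·fᵢ(Φ̄(ξ)X, ū)] from ℝ^n × ℝ^{d_u} to ℝ is Lipschitz with constant (K/k)·E[L(ξ)]. -/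
open MeasureTheory Matrix

/-- The Euclidean length of `(A *ᵥ x, y)` is at most the spectral norm of `blkdiag(A, I)` times the
Euclidean length of `(x, y)`. -/
theorem sqrt_sum_sq_mulVec_add_le {l m n : Type*} [Fintype l] [Fintype m] [Fintype n]
    [DecidableEq m] [DecidableEq n] (A : Matrix l n ℝ) (x : n → ℝ) (y : m → ℝ) :
    Real.sqrt ((∑ i, (A.mulVec x) i ^ 2) + ∑ i, y i ^ 2)
      ≤ ‖LinearMap.toContinuousLinearMap (Matrix.toEuclideanLin
            (Matrix.fromBlocks A 0 0 (1 : Matrix m m ℝ)))‖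
          * Real.sqrt ((∑ i, x i ^ 2) + ∑ i, y i ^ 2) := by
  have h := (LinearMap.toContinuousLinearMap (Matrix.toEuclideanLin
    (Matrix.fromBlocks A 0 0 (1 : Matrix m m ℝ)))).le_opNorm (WithLp.toLp 2 (Sum.elim x y))
  simpa [EuclideanSpace.norm_eq, Matrix.fromBlocks_mulVec, Matrix.toLpLin_toLp] using h

/-- A real function on a product that is Lipschitz for the Euclidean norm is continuous. -/
theorem continuous_of_abs_sub_le_mul_sqrt {m n : Type*} [Fintype m] [Fintype n]
    {g : (m → ℝ) × (n → ℝ) → ℝ} {K : ℝ}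
    (hg : ∀ s t, |g s - g t|
      ≤ K * Real.sqrt ((∑ i, (s.1 i - t.1 i) ^ 2) + ∑ i, (s.2 i - t.2 i) ^ 2)) :
    Continuous g := by
  refine continuous_iff_continuousAt.2 fun t => tendsto_iff_dist_tendsto_zero.2 ?_
  refine squeeze_zero (fun _ => dist_nonneg) (fun s => hg s t) ?_
  have hc : Continuous fun s : (m → ℝ) × (n → ℝ) =>
      K * Real.sqrt ((∑ i, (s.1 i - t.1 i) ^ 2) + ∑ i, (s.2 i - t.2 i) ^ 2) := by fun_prop
  simpa using hc.tendsto t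

/-- **Proposition 2 (core Lipschitz estimate).** If `f` is globally `K`-Lipschitz
(in the Euclidean norm on the product), then each gPC-projected drift component
`(X, ū) ↦ (1/k)·E[φ(ξ)·fᵢ(Φ̄(ξ)X, ū)]` is Lipschitz with constant
`(K/k)·E[L(ξ)]`, where `L(ξ) = |φ(ξ)|·‖blkdiag(Φ̄(ξ), I)‖₂` (spectral norm). -/
theorem gpc_projected_drift_lipschitz
    {Ω : Type*} [MeasurableSpace Ω] (P : Measure Ω) [IsProbabilityMeasure P]
    {dξ d du n : ℕ} (ξ : Ω → Fin dξ → ℝ) (hξ : Measurable ξ)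
    (φ : (Fin dξ → ℝ) → ℝ) (hφ : Measurable φ)
    (k : ℝ) (hk : k = ∫ ω, φ (ξ ω) ^ 2 ∂P) (hkpos : 0 < k)
    (Φbar : (Fin dξ → ℝ) → Matrix (Fin d) (Fin n) ℝ)
    (hΦbar : ∀ i j, Measurable fun z => Φbar z i j)
    (f : (Fin d → ℝ) × (Fin du → ℝ) → Fin d → ℝ) (K : ℝ)
    (hf : ∀ s₁ s₂ : (Fin d → ℝ) × (Fin du → ℝ),
      Real.sqrt (∑ i, (f s₁ i - f s₂ i) ^ 2)
        ≤ K * Real.sqrt ((∑ i, (s₁.1 i - s₂.1 i) ^ 2) + ∑ i, (s₁.2 i - s₂.2 i) ^ 2))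
    (L : Ω → ℝ)
    (hL : ∀ ω, L ω = |φ (ξ ω)|
        * ‖LinearMap.toContinuousLinearMap (Matrix.toEuclideanLin
            (Matrix.fromBlocks (Φbar (ξ ω)) 0 0
              (1 : Matrix (Fin du) (Fin du) ℝ)))‖)
    (hLint : Integrable L P) :
    ∀ i : Fin d, ∀ X X' : Fin n → ℝ, ∀ u u' : Fin du → ℝ,
      |(1 / k) * (∫ ω, φ (ξ ω) * f ((Φbar (ξ ω)).mulVec X, u) i ∂P)
          - (1 / k) * (∫ ω, φ (ξ ω) * f ((Φbar (ξ ω)).mulVec X', u') i ∂P)|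
        ≤ (K / k) * (∫ ω, L ω ∂P)
            * Real.sqrt ((∑ j, (X j - X' j) ^ 2) + ∑ j, (u j - u' j) ^ 2) := by
  intro i X X' u u'
  have hcomp : ∀ s t : (Fin d → ℝ) × (Fin du → ℝ), |f s i - f t i|
      ≤ K * Real.sqrt ((∑ i, (s.1 i - t.1 i) ^ 2) + ∑ i, (s.2 i - t.2 i) ^ 2) := fun s t =>
    (Real.abs_le_sqrt (Finset.single_le_sum (f := fun i => (f s i - f t i) ^ 2)
      (fun _ _ => sq_nonneg _) (Finset.mem_univ i))).trans (hf s t)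
  have hK : 0 ≤ K := by
    have h := (abs_nonneg _).trans (hcomp (Pi.single i 1, 0) 0)
    refine nonneg_of_mul_nonneg_left h (Real.sqrt_pos.2 ?_)
    simp [Pi.single_apply]
  have hfi : Continuous fun s => f s i := continuous_of_abs_sub_le_mul_sqrt hcomp
  have hφξ : Measurable fun ω => φ (ξ ω) := hφ.comp hξ
  have hφint : Integrable (fun ω => φ (ξ ω)) P := by
    have hsq : Integrable (fun ω => φ (ξ ω) ^ 2) P :=
      Integrable.of_integral_ne_zero (hk ▸ hkpos.ne')
    exact ((memLp_two_iff_integrable_sq hφξ.aestronglyMeasurable).2 hsq).integrable one_le_two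
  have hmul : ∀ (ω : Ω) (Y Y' : Fin n → ℝ) (v v' : Fin du → ℝ),
      |φ (ξ ω) * f ((Φbar (ξ ω)).mulVec Y, v) i - φ (ξ ω) * f ((Φbar (ξ ω)).mulVec Y', v') i|
        ≤ K * Real.sqrt ((∑ j, (Y j - Y' j) ^ 2) + ∑ j, (v j - v' j) ^ 2) * L ω := by
    intro ω Y Y' v v'
    have hb := sqrt_sum_sq_mulVec_add_le (Φbar (ξ ω)) (Y - Y') (v - v')
    simp only [Matrix.mulVec_sub, Pi.sub_apply] at hb
    have h := (hcomp ((Φbar (ξ ω)).mulVec Y, v) ((Φbar (ξ ω)).mulVec Y', v')).trans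
      (mul_le_mul_of_nonneg_left hb hK)
    rw [← mul_sub, abs_mul, hL]
    exact (mul_le_mul_of_nonneg_left h (abs_nonneg _)).trans_eq (by ring)
  have hint : ∀ (Y : Fin n → ℝ) (v : Fin du → ℝ),
      Integrable (fun ω => φ (ξ ω) * f ((Φbar (ξ ω)).mulVec Y, v) i) P := by
    intro Y v
    have hmv : Measurable fun ω => (Φbar (ξ ω)).mulVec Y :=
      measurable_pi_lambda _ fun j => by
        simp only [Matrix.mulVec, dotProduct]
        exact Finset.measurable_fun_sum _ fun l _ => ((hΦbar j l).comp hξ).mul_const _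
    have hmeas : Measurable fun ω => φ (ξ ω) * f ((Φbar (ξ ω)).mulVec Y, v) i :=
      hφξ.mul (hfi.measurable.comp (hmv.prodMk measurable_const))
    have hzero : Integrable (fun ω => φ (ξ ω) * f ((Φbar (ξ ω)).mulVec 0, 0) i) P := by
      simpa only [Matrix.mulVec_zero] using hφint.mul_const (f (0, 0) i)
    have hdiff : Integrable (fun ω => φ (ξ ω) * f ((Φbar (ξ ω)).mulVec Y, v) i
        - φ (ξ ω) * f ((Φbar (ξ ω)).mulVec 0, 0) i) P :=
      (hLint.const_mul _).mono' (hmeas.aestronglyMeasurable.sub hzero.aestronglyMeasurable)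
        (Filter.Eventually.of_forall fun ω => hmul ω Y 0 v 0)
    exact (hdiff.add hzero).congr (Filter.Eventually.of_forall fun _ => sub_add_cancel _ _)
  rw [← mul_sub, ← integral_sub (hint X u) (hint X' u'), abs_mul, abs_of_pos (one_div_pos.2 hkpos)]
  have h := norm_integral_le_of_norm_le (μ := P)
    (f := fun ω => φ (ξ ω) * f ((Φbar (ξ ω)).mulVec X, u) i
      - φ (ξ ω) * f ((Φbar (ξ ω)).mulVec X', u') i)
    (hLint.const_mul _) (Filter.Eventually.of_forall fun ω => hmul ω X X' u u')
  rw [integral_const_mul] at h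
  exact (mul_le_mul_of_nonneg_left h (one_div_pos.2 hkpos).le).trans_eq (by ring)
end
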